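/- Let p ∈ (0,1), let Z be an exponentially distributed random variable with E[Z] = 1, and set A(t) = exp(t/p). Define X̃_t = A(Z)·1_{[Z,∞)}(t) and G̃_t = ∫₀^{t∧Z} A(s) ds for t ≥ 0. Then for every t ≥ 0: E[X̃_t^p] = t, and E[G̃_t^p] ≤ p^p (t+1). Consequently E[(sup_{s≥0} G̃_{s∧n})^p] ≤ p^p(n+1) and E[(sup_{s≥0} X̃_{s∧n})^p]/E[(sup_{s≥0} G̃_{s∧n})^p] → p^{-p} as n → ∞. -/

import Mathlib

open MeasureTheory Filter Set
open scoped ENNReal NNReal Topology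

noncomputable section

/-- A nonnegative random variable with tail `exp (-x)` has density `exp (-x)` on `[0, ∞)`. -/
lemma map_eq_withDensity_exp_neg {Ω : Type*} {m : MeasurableSpace Ω} {μ : Measure Ω}
    [IsProbabilityMeasure μ] {Z : Ω → ℝ} (hZmeas : Measurable Z) (hZnonneg : ∀ ω, 0 ≤ Z ω)
    (hZexp : ∀ x : ℝ, 0 ≤ x → μ {ω | x ≤ Z ω} = ENNReal.ofReal (Real.exp (-x))) :
    μ.map Z =
      (volume.restrict (Ici (0 : ℝ))).withDensity fun x => ENNReal.ofReal (Real.exp (-x)) := by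
  have : IsProbabilityMeasure (μ.map Z) := Measure.isProbabilityMeasure_map hZmeas.aemeasurable
  refine Measure.ext_of_Ici _ _ fun x => ?_
  have hset : Z ⁻¹' Ici x = {ω | max x 0 ≤ Z ω} := by
    ext ω
    simp [hZnonneg ω]
  rw [Measure.map_apply hZmeas measurableSet_Ici, hset, hZexp _ (le_max_right _ _),
    withDensity_apply _ measurableSet_Ici, Measure.restrict_restrict measurableSet_Ici,
    Ici_inter_Ici, setLIntegral_congr Ioi_ae_eq_Ici.symm,
    ← ofReal_integral_eq_lintegral_ofReal (integrableOn_exp_neg_Ioi _)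
      (Eventually.of_forall fun y => (Real.exp_pos _).le), integral_exp_neg_Ioi]

/-- For a standard exponential `Z`, the truncated exponential moment `E[exp Z; Z ≤ t]` is `t`. -/
lemma lintegral_exp_of_le {Ω : Type*} {m : MeasurableSpace Ω} {μ : Measure Ω}
    [IsProbabilityMeasure μ] {Z : Ω → ℝ} (hZmeas : Measurable Z) (hZnonneg : ∀ ω, 0 ≤ Z ω)
    (hZexp : ∀ x : ℝ, 0 ≤ x → μ {ω | x ≤ Z ω} = ENNReal.ofReal (Real.exp (-x))) (t : ℝ) :
    ∫⁻ ω, (Iic t).indicator (fun x => ENNReal.ofReal (Real.exp x)) (Z ω) ∂μ =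
      ENNReal.ofReal t := by
  have hf : Measurable ((Iic t).indicator fun x => ENNReal.ofReal (Real.exp x)) :=
    (by fun_prop : Measurable fun x => ENNReal.ofReal (Real.exp x)).indicator measurableSet_Iic
  rw [← lintegral_map hf hZmeas, map_eq_withDensity_exp_neg hZmeas hZnonneg hZexp,
    lintegral_withDensity_eq_lintegral_mul _ (by fun_prop) hf]
  have hone : ((fun x => ENNReal.ofReal (Real.exp (-x))) *
      (Iic t).indicator fun x => ENNReal.ofReal (Real.exp x)) = (Iic t).indicator 1 := by
    ext x
    by_cases hx : x ∈ Iic t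
    · simp [hx, ← ENNReal.ofReal_mul (Real.exp_pos _).le, ← Real.exp_add]
    · simp [hx]
  rw [hone, lintegral_indicator_one measurableSet_Iic, Measure.restrict_apply measurableSet_Iic,
    inter_comm, Ici_inter_Iic, Real.volume_Icc, sub_zero]

/-- For a standard exponential `Z`, `E[exp (t ∧ Z)] = t + 1`. -/
lemma lintegral_exp_min {Ω : Type*} {m : MeasurableSpace Ω} {μ : Measure Ω}
    [IsProbabilityMeasure μ] {Z : Ω → ℝ} (hZmeas : Measurable Z) (hZnonneg : ∀ ω, 0 ≤ Z ω)
    (hZexp : ∀ x : ℝ, 0 ≤ x → μ {ω | x ≤ Z ω} = ENNReal.ofReal (Real.exp (-x)))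
    {t : ℝ} (ht : 0 ≤ t) :
    ∫⁻ ω, ENNReal.ofReal (Real.exp (min t (Z ω))) ∂μ = ENNReal.ofReal (t + 1) := by
  have htail : μ (Z ⁻¹' Ioi t) = ENNReal.ofReal (Real.exp (-t)) := by
    have hIci : μ (Z ⁻¹' Ici t) = ENNReal.ofReal (Real.exp (-t)) := hZexp t ht
    rw [← hIci, ← Measure.map_apply hZmeas measurableSet_Ioi,
      ← Measure.map_apply hZmeas measurableSet_Ici,
      map_eq_withDensity_exp_neg hZmeas hZnonneg hZexp]
    exact measure_congr ((withDensity_absolutelyContinuous _ _).ae_le Ioi_ae_eq_Ici)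
  have hsplit : ∀ ω, ENNReal.ofReal (Real.exp (min t (Z ω))) =
      (Iic t).indicator (fun x => ENNReal.ofReal (Real.exp x)) (Z ω) +
        (Z ⁻¹' Ioi t).indicator (fun _ => ENNReal.ofReal (Real.exp t)) ω := by
    intro ω
    rcases le_or_gt (Z ω) t with h | h
    · simp [h, h.not_gt, indicator]
    · simp [h, h.le, h.not_ge, indicator]
  simp_rw [hsplit]
  rw [lintegral_add_right _ (measurable_const.indicator (hZmeas measurableSet_Ioi)),
    lintegral_exp_of_le hZmeas hZnonneg hZexp,
    lintegral_indicator_const (hZmeas measurableSet_Ioi), htail,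
    ← ENNReal.ofReal_mul (Real.exp_pos _).le, ← Real.exp_add, add_neg_cancel, Real.exp_zero,
    ENNReal.ofReal_add ht zero_le_one]

lemma integral_exp_div {p : ℝ} (hp : p ≠ 0) (y : ℝ) :
    ∫ s in (0 : ℝ)..y, Real.exp (s / p) = p * (Real.exp (y / p) - 1) := by
  rw [intervalIntegral.integral_comp_div (fun s => Real.exp s) hp, integral_exp]
  simp

lemma exp_div_rpow {p : ℝ} (hp : p ≠ 0) (y : ℝ) : Real.exp (y / p) ^ p = Real.exp y := by
  rw [← Real.exp_mul, div_mul_cancel₀ _ hp]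

lemma rpow_mul_exp_div_sub_one_le {p y : ℝ} (hp : 0 < p) (hy : 0 ≤ y) :
    (p * (Real.exp (y / p) - 1)) ^ p ≤ p ^ p * Real.exp y := by
  have h1 : 1 ≤ Real.exp (y / p) := Real.one_le_exp (div_nonneg hy hp.le)
  rw [Real.mul_rpow hp.le (by linarith), ← exp_div_rpow hp.ne' y]
  gcongr
  linarith

lemma rpow_mul_exp_le_rpow_add {p y : ℝ} (hp : 0 < p) (hp1 : p ≤ 1) (hy : 0 ≤ y) :
    p ^ p * Real.exp y ≤ (p * (Real.exp (y / p) - 1)) ^ p + p ^ p := by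
  have h1 : 1 ≤ Real.exp (y / p) := Real.one_le_exp (div_nonneg hy hp.le)
  have h2 := Real.rpow_add_le_add_rpow (sub_nonneg.2 h1) zero_le_one hp.le hp1
  rw [sub_add_cancel, exp_div_rpow hp.ne', Real.one_rpow] at h2
  rw [Real.mul_rpow hp.le (by linarith)]
  nlinarith [Real.rpow_pos_of_pos hp p]

/-- The supremum of a monotone process stopped at `n` is its value at `n`. -/
lemma iSup_ofReal_min_eq {f : ℝ≥0 → ℝ} (hf : Monotone f) (n : ℝ≥0) :
    ⨆ s : ℝ≥0, ENNReal.ofReal (f (min s n)) = ENNReal.ofReal (f n) :=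
  le_antisymm (iSup_le fun _ => ENNReal.ofReal_le_ofReal (hf (min_le_right _ _)))
    (le_iSup_of_le n (by rw [min_self]))

/-- The explicit computations (4) in the proof of Theorem 2: for `Z` standard
exponentially distributed, `A(t) = exp(t/p)`, `X̃_t = A(Z) 1_{[Z,∞)}(t)` and
`G̃_t = ∫_0^{t∧Z} A(s) ds`, one has `E[X̃_t^p] = t`, `E[G̃_t^p] ≤ p^p (t+1)`,
hence `E[(sup_s G̃_{s∧n})^p] ≤ p^p (n+1)` and the ratio of the `p`-th moments of
the suprema of the stopped processes tends to `p^{-p}`. -/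
theorem exponential_example_moments
    {Ω : Type*} {m : MeasurableSpace Ω} (μ : Measure Ω) [IsProbabilityMeasure μ]
    (p : ℝ) (hp : p ∈ Set.Ioo (0 : ℝ) 1)
    (Z : Ω → ℝ) (hZmeas : Measurable Z) (hZnonneg : ∀ ω, 0 ≤ Z ω)
    (hZexp : ∀ x : ℝ, 0 ≤ x → μ {ω | x ≤ Z ω} = ENNReal.ofReal (Real.exp (-x)))
    (X G : ℝ≥0 → Ω → ℝ)
    (hX : ∀ t ω, X t ω = if Z ω ≤ t then Real.exp (Z ω / p) else 0)
    (hG : ∀ t ω, G t ω = ∫ s in (0 : ℝ)..(min (t : ℝ) (Z ω)), Real.exp (s / p)) :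
    (∀ t : ℝ≥0, ∫⁻ ω, ENNReal.ofReal (X t ω) ^ p ∂μ = ENNReal.ofReal t) ∧
    (∀ t : ℝ≥0, ∫⁻ ω, ENNReal.ofReal (G t ω) ^ p ∂μ ≤
      ENNReal.ofReal (p ^ p * ((t : ℝ) + 1))) ∧
    (∀ n : ℕ, ∫⁻ ω, (⨆ s : ℝ≥0, ENNReal.ofReal (G (min s n) ω)) ^ p ∂μ ≤
      ENNReal.ofReal (p ^ p * ((n : ℝ) + 1))) ∧
    Tendsto (fun n : ℕ =>
        (∫⁻ ω, (⨆ s : ℝ≥0, ENNReal.ofReal (X (min s n) ω)) ^ p ∂μ) /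
        (∫⁻ ω, (⨆ s : ℝ≥0, ENNReal.ofReal (G (min s n) ω)) ^ p ∂μ))
      atTop (𝓝 (ENNReal.ofReal (p ^ (-p)))) := by
  obtain ⟨hp0, hp1⟩ := hp
  have hpp : 0 < p ^ p := Real.rpow_pos_of_pos hp0 p
  have hmin : ∀ (t : ℝ≥0) ω, 0 ≤ min (t : ℝ) (Z ω) := fun t ω => le_min t.2 (hZnonneg ω)
  have hG' : ∀ t ω, G t ω = p * (Real.exp (min (t : ℝ) (Z ω) / p) - 1) := fun t ω => by
    rw [hG, integral_exp_div hp0.ne']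
  have hGnonneg : ∀ t ω, 0 ≤ G t ω := fun t ω => by
    rw [hG']
    exact mul_nonneg hp0.le (sub_nonneg.2 (Real.one_le_exp (div_nonneg (hmin t ω) hp0.le)))
  have hXmono : ∀ ω, Monotone fun t => X t ω := fun ω s t hst => by
    have hst' : (s : ℝ) ≤ t := hst
    simp only [hX]
    split_ifs with h1 h2
    · exact le_rfl
    · exact absurd (h1.trans hst') h2
    · exact (Real.exp_pos _).le
    · exact le_rfl
  have hGmono : ∀ ω, Monotone fun t => G t ω := fun ω s t hst => by
    have hst' : (s : ℝ) ≤ t := hst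
    simp only [hG']
    gcongr
  have hXmom : ∀ t : ℝ≥0, ∫⁻ ω, ENNReal.ofReal (X t ω) ^ p ∂μ = ENNReal.ofReal t := fun t => by
    rw [← lintegral_exp_of_le hZmeas hZnonneg hZexp]
    refine lintegral_congr fun ω => ?_
    by_cases h : Z ω ≤ t
    · simp [hX, h, indicator, ENNReal.ofReal_rpow_of_pos (Real.exp_pos _), exp_div_rpow hp0.ne']
    · simp [hX, h, indicator, hp0]
  have hGmom : ∀ t : ℝ≥0, ∫⁻ ω, ENNReal.ofReal (G t ω) ^ p ∂μ ≤
      ENNReal.ofReal (p ^ p * ((t : ℝ) + 1)) := fun t => by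
    rw [ENNReal.ofReal_mul hpp.le, ← lintegral_exp_min hZmeas hZnonneg hZexp t.coe_nonneg,
      ← lintegral_const_mul' _ _ ENNReal.ofReal_ne_top]
    refine lintegral_mono fun ω => ?_
    rw [ENNReal.ofReal_rpow_of_nonneg (hGnonneg t ω) hp0.le, ← ENNReal.ofReal_mul hpp.le, hG']
    exact ENNReal.ofReal_le_ofReal (rpow_mul_exp_div_sub_one_le hp0 (hmin t ω))
  have hGlower : ∀ t : ℝ≥0, ENNReal.ofReal (p ^ p * t) ≤
      ∫⁻ ω, ENNReal.ofReal (G t ω) ^ p ∂μ := fun t => by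
    refine (ENNReal.add_le_add_iff_right (ENNReal.ofReal_ne_top (r := p ^ p))).1 ?_
    calc ENNReal.ofReal (p ^ p * t) + ENNReal.ofReal (p ^ p)
        = ENNReal.ofReal (p ^ p) * ENNReal.ofReal ((t : ℝ) + 1) := by
          rw [← ENNReal.ofReal_add (by positivity) hpp.le, ← ENNReal.ofReal_mul hpp.le]
          ring_nf
      _ = ∫⁻ ω, ENNReal.ofReal (p ^ p) * ENNReal.ofReal (Real.exp (min (t : ℝ) (Z ω))) ∂μ := by
          rw [← lintegral_exp_min hZmeas hZnonneg hZexp t.coe_nonneg,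
            lintegral_const_mul' _ _ ENNReal.ofReal_ne_top]
      _ ≤ ∫⁻ ω, (ENNReal.ofReal (G t ω) ^ p + ENNReal.ofReal (p ^ p)) ∂μ := by
          refine lintegral_mono fun ω => ?_
          rw [ENNReal.ofReal_rpow_of_nonneg (hGnonneg t ω) hp0.le, ← ENNReal.ofReal_mul hpp.le,
            ← ENNReal.ofReal_add (Real.rpow_nonneg (hGnonneg t ω) p) hpp.le, hG']
          exact ENNReal.ofReal_le_ofReal (rpow_mul_exp_le_rpow_add hp0 hp1.le (hmin t ω))
      _ = ∫⁻ ω, ENNReal.ofReal (G t ω) ^ p ∂μ + ENNReal.ofReal (p ^ p) := by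
          rw [lintegral_add_right _ measurable_const, lintegral_const, measure_univ, mul_one]
  simp_rw [fun (n : ℕ) ω => iSup_ofReal_min_eq (hXmono ω) n,
    fun (n : ℕ) ω => iSup_ofReal_min_eq (hGmono ω) n, hXmom]
  refine ⟨fun _ => trivial, hGmom, fun n => by simpa using hGmom n, ?_⟩
  have hlim : Tendsto (fun n : ℕ => ENNReal.ofReal n / ENNReal.ofReal (p ^ p * ((n : ℝ) + 1)))
      atTop (𝓝 (ENNReal.ofReal (p ^ (-p)))) := by
    have hreal : Tendsto (fun n : ℕ => p ^ (-p) * ((n : ℝ) / ((n : ℝ) + 1))) atTop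
        (𝓝 (p ^ (-p))) := by
      simpa using (tendsto_natCast_div_add_atTop (1 : ℝ)).const_mul (p ^ (-p))
    refine (ENNReal.tendsto_ofReal hreal).congr fun n => ?_
    rw [← ENNReal.ofReal_div_of_pos (by positivity), Real.rpow_neg hp0.le]
    congr 1
    field_simp
  refine tendsto_of_tendsto_of_tendsto_of_le_of_le' hlim tendsto_const_nhds
    (Eventually.of_forall fun n => ?_) ?_
  · exact ENNReal.div_le_div (by simp) (by simpa using hGmom n)
  · filter_upwards [eventually_gt_atTop 0] with n hn
    have hn' : (0 : ℝ) < n := Nat.cast_pos.2 hn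
    calc _ ≤ ENNReal.ofReal n / ENNReal.ofReal (p ^ p * n) :=
          ENNReal.div_le_div (by simp) (by simpa using hGlower n)
      _ = ENNReal.ofReal (p ^ (-p)) := by
          rw [← ENNReal.ofReal_div_of_pos (by positivity), Real.rpow_neg hp0.le]
          congr 1
          field_simp
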